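/- arXiv:2305.04962 — 5 statements merged into one kernel-verified Lean document; each statement's English description precedes it below -/
import Mathlib

section
/- Let H be a real Hilbert space, φ₁, …, φ_N continuous linear functionals on H with Riesz representers r₁, …, r_N, and let the Gram matrix K ∈ ℝ^{N×N}, K_{nk} = ⟪r_n, r_k⟫, be invertible. Let F : ℝ^N → ℝ^M be any map and y ∈ ℝ^M. Then an element u† ∈ H is a minimizer of the norm ‖u‖ over the feasible set {u ∈ H : F(φ₁(u), …, φ_N(u)) = y} if and only if there exists z† ∈ ℝ^N such that: F(z†) = y; z† minimizes the quadratic form zᵀK⁻¹z over {z ∈ ℝ^N : F(z) = y}; and u† = Σ_{n=1}^N (K⁻¹z†)_n r_n. -/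
open scoped RealInnerProductSpace
open Matrix

/-- A combination of the `r n` pairs with `u` through the values `⟪r n, u⟫`. -/
lemma inner_sum_smul_eq_dotProduct {ι H : Type*} [Fintype ι] [NormedAddCommGroup H]
    [InnerProductSpace ℝ H] (r : ι → H) (a : ι → ℝ) (u : H) :
    ⟪∑ n, a n • r n, u⟫ = (fun n => ⟪r n, u⟫) ⬝ᵥ a := by
  simp [sum_inner, real_inner_smul_left, dotProduct, mul_comm]

/-- The interpolant with coefficients `K⁻¹ z` has measurements `z`. -/
lemma inner_interpolant {ι H : Type*} [Fintype ι] [DecidableEq ι] [NormedAddCommGroup H]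
    [InnerProductSpace ℝ H] {r : ι → H} {K : Matrix ι ι ℝ}
    (hK : ∀ n k, K n k = ⟪r n, r k⟫) (hKinv : IsUnit K.det) (z : ι → ℝ) (n : ι) :
    ⟪r n, ∑ k, (K⁻¹ *ᵥ z) k • r k⟫ = z n := by
  have h : K *ᵥ (K⁻¹ *ᵥ z) = z := by
    rw [mulVec_mulVec, mul_nonsing_inv K hKinv, one_mulVec]
  rw [← congrFun h n]
  simp only [inner_sum, real_inner_smul_right, ← hK]
  rw [mulVec, dotProduct]
  exact Finset.sum_congr rfl fun k _ => mul_comm _ _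

/-- The squared norm of the interpolant is the quadratic form of `K⁻¹`. -/
lemma norm_sq_interpolant {ι H : Type*} [Fintype ι] [DecidableEq ι] [NormedAddCommGroup H]
    [InnerProductSpace ℝ H] {r : ι → H} {K : Matrix ι ι ℝ}
    (hK : ∀ n k, K n k = ⟪r n, r k⟫) (hKinv : IsUnit K.det) (z : ι → ℝ) :
    ‖∑ k, (K⁻¹ *ᵥ z) k • r k‖ ^ 2 = z ⬝ᵥ K⁻¹ *ᵥ z := by
  rw [← real_inner_self_eq_norm_sq, inner_sum_smul_eq_dotProduct]
  simp only [inner_interpolant hK hKinv]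

/-- Pythagorean decomposition of `u` relative to the interpolant of its measurements. -/
lemma norm_sq_eq_dotProduct_add {ι H : Type*} [Fintype ι] [DecidableEq ι] [NormedAddCommGroup H]
    [InnerProductSpace ℝ H] {r : ι → H} {K : Matrix ι ι ℝ}
    (hK : ∀ n k, K n k = ⟪r n, r k⟫) (hKinv : IsUnit K.det) {z : ι → ℝ} {u : H}
    (hu : ∀ n, ⟪r n, u⟫ = z n) :
    ‖u‖ ^ 2 = z ⬝ᵥ K⁻¹ *ᵥ z + ‖u - ∑ k, (K⁻¹ *ᵥ z) k • r k‖ ^ 2 := by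
  rw [norm_sub_sq_real, norm_sq_interpolant hK hKinv, real_inner_comm,
    inner_sum_smul_eq_dotProduct]
  simp only [hu]
  ring

/-- Representer theorem: `u†` minimizes the RKHS norm subject to the nonlinear
constraints `F([φ, u]) = y` iff it is given by the representer formula with
coefficients `K⁻¹ z†`, where `z†` minimizes `zᵀ K⁻¹ z` subject to `F(z) = y`. -/
theorem representer_theorem
    {H : Type*} [NormedAddCommGroup H] [InnerProductSpace ℝ H] [CompleteSpace H]
    {N M : ℕ} (φ : Fin N → H →L[ℝ] ℝ) (r : Fin N → H)
    (hr : ∀ (n : Fin N) (u : H), φ n u = ⟪r n, u⟫)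
    (K : Matrix (Fin N) (Fin N) ℝ)
    (hK : ∀ n k : Fin N, K n k = ⟪r n, r k⟫)
    (hKinv : IsUnit K.det)
    (F : (Fin N → ℝ) → (Fin M → ℝ)) (y : Fin M → ℝ) (udag : H) :
    (F (fun n => φ n udag) = y ∧
        ∀ u : H, F (fun n => φ n u) = y → ‖udag‖ ≤ ‖u‖) ↔
      ∃ zdag : Fin N → ℝ,
        F zdag = y ∧
        (∀ z : Fin N → ℝ, F z = y →
          zdag ⬝ᵥ K⁻¹.mulVec zdag ≤ z ⬝ᵥ K⁻¹.mulVec z) ∧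
        udag = ∑ n : Fin N, (K⁻¹.mulVec zdag) n • r n := by
  simp only [hr]
  constructor
  · rintro ⟨hF, hmin⟩
    refine ⟨fun n => ⟪r n, udag⟫, hF, fun z hz => ?_, ?_⟩
    · have h := hmin (∑ k, (K⁻¹ *ᵥ z) k • r k) (by simpa only [inner_interpolant hK hKinv] using hz)
      have h2 := pow_le_pow_left₀ (norm_nonneg _) h 2
      rw [norm_sq_interpolant hK hKinv,
        norm_sq_eq_dotProduct_add hK hKinv (u := udag) fun _ => rfl] at h2
      exact (le_add_of_nonneg_right (sq_nonneg _)).trans h2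
    · have h := hmin (∑ k, (K⁻¹ *ᵥ fun n => ⟪r n, udag⟫) k • r k)
        (by simpa only [inner_interpolant hK hKinv] using hF)
      have h2 := pow_le_pow_left₀ (norm_nonneg _) h 2
      rw [norm_sq_interpolant hK hKinv,
        norm_sq_eq_dotProduct_add hK hKinv (u := udag) fun _ => rfl] at h2
      rw [← sub_eq_zero, ← norm_eq_zero, ← sq_eq_zero_iff]
      exact le_antisymm (by linarith) (sq_nonneg _)
  · rintro ⟨z, hF, hmin, rfl⟩
    refine ⟨by simpa only [inner_interpolant hK hKinv] using hF, fun u hu => ?_⟩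
    rw [← sq_le_sq₀ (norm_nonneg _) (norm_nonneg _), norm_sq_interpolant hK hKinv,
      norm_sq_eq_dotProduct_add hK hKinv (u := u) fun _ => rfl]
    exact (hmin _ hu).trans (le_add_of_nonneg_right (sq_nonneg _))
end

section
/- Let Ω ⊆ ℝ^d (d ≥ 1) be a compact set with Lebesgue measure vol(Ω) > 0, and let μ_Ω := vol(Ω)⁻¹·(Lebesgue measure restricted to Ω) be the uniform probability measure on Ω. Suppose there exist constants c > 0 and r₀ > 0 such that vol(Ω ∩ B(x, r)) ≥ c·r^d for every x ∈ Ω and every r ∈ (0, r₀). Then there exists a constant C > 0, independent of the number of samples and of the confidence level, such that for every integer N ≥ 2 and every δ ∈ (0, 1), the product measure μ_Ω^{⊗N} of the set of N-tuples (x₁, …, x_N) ∈ (ℝ^d)^N whose fill distance satisfies sup_{x' ∈ Ω} min_{1 ≤ i ≤ N} |x' − x_i| ≤ C·(log(N/δ)/N)^{1/d} is at least 1 − δ. -/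
open MeasureTheory

/-- A totally bounded set has a finite `s`-net whose balls of radius `s / 2` are disjoint. -/
theorem exists_finset_net_of_totallyBounded {X : Type*} [PseudoMetricSpace X] {Ω : Set X}
    (hΩ : TotallyBounded Ω) {s : ℝ} (hs : 0 < s) :
    ∃ t : Finset X, (∀ y ∈ t, y ∈ Ω) ∧ (∀ x ∈ Ω, ∃ y ∈ t, dist x y ≤ s) ∧
      (t : Set X).PairwiseDisjoint fun y => Metric.ball y (s / 2) := by
  obtain ⟨ε, rfl⟩ : ∃ ε : NNReal, s = (2 * ε : NNReal) :=
    ⟨(s / 2).toNNReal, by push_cast; rw [Real.coe_toNNReal _ (by positivity)]; ring⟩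
  have hε : ε ≠ 0 := by rintro rfl; simp at hs
  obtain ⟨n, -, hnfin, hn⟩ := Metric.exists_finite_isCover_of_totallyBounded hε hΩ
  have hpack : Metric.packingNumber (2 * ε) Ω ≠ ⊤ :=
    ne_top_of_le_ne_top (Set.encard_ne_top_iff.2 hnfin)
      ((Metric.packingNumber_two_mul_le_externalCoveringNumber ε Ω).trans
        hn.externalCoveringNumber_le_encard)
  have hfin : (Metric.maximalSeparatedSet (2 * ε) Ω).Finite := by
    rw [← Set.encard_ne_top_iff, Metric.encard_maximalSeparatedSet hpack]
    exact hpack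
  refine ⟨hfin.toFinset, fun y hy => Metric.maximalSeparatedSet_subset (hfin.mem_toFinset.1 hy),
    fun x hx => ?_, ?_⟩
  · have h := (Metric.isCover_maximalSeparatedSet hpack).subset_iUnion_closedBall hx
    simp only [Set.mem_iUnion, Metric.mem_closedBall] at h
    obtain ⟨y, hy, hxy⟩ := h
    exact ⟨y, hfin.mem_toFinset.2 hy, hxy⟩
  · intro x hx y hy hxy
    have h := Metric.isSeparated_maximalSeparatedSet (hfin.mem_toFinset.1 hx)
      (hfin.mem_toFinset.1 hy) hxy
    refine Metric.ball_disjoint_ball ?_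
    beta_reduce at h
    rw [edist_nndist, ENNReal.coe_lt_coe, ← NNReal.coe_lt_coe, coe_nndist] at h
    linarith

/-- If all balls of radii `s / 2` and `s` centred in `Ω` have mass at least `b` and `m`
respectively, then `N` samples fail to be `2 * s`-dense in `Ω` with probability at most
`b⁻¹ * exp (-N * m)`. -/
theorem one_sub_le_measureReal_pi_dense {X : Type*} [PseudoMetricSpace X] [MeasurableSpace X]
    [OpensMeasurableSpace X] (μ : Measure X) [IsProbabilityMeasure μ] {Ω : Set X}
    (hΩ : TotallyBounded Ω) {s b m : ℝ} (hs : 0 < s) (hb : 0 < b)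
    (hball_half : ∀ x ∈ Ω, b ≤ μ.real (Metric.ball x (s / 2)))
    (hball : ∀ x ∈ Ω, m ≤ μ.real (Metric.ball x s)) (N : ℕ) :
    1 - b⁻¹ * Real.exp (-(N * m)) ≤ (Measure.pi fun _ : Fin N => μ).real
      {x | ∀ x' ∈ Ω, ∃ i, dist x' (x i) ≤ 2 * s} := by
  obtain ⟨t, htΩ, hcover, hdisj⟩ := exists_finset_net_of_totallyBounded hΩ hs
  have hcard : (t.card : ℝ) ≤ b⁻¹ := by
    have h1 : ∑ y ∈ t, μ.real (Metric.ball y (s / 2)) ≤ 1 := by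
      rw [← measureReal_biUnion_finset hdisj fun _ _ => Metric.isOpen_ball.measurableSet]
      exact measureReal_le_one
    have h2 := Finset.card_nsmul_le_sum t _ b fun y hy => hball_half y (htΩ y hy)
    rw [nsmul_eq_mul] at h2
    rw [← one_div, le_div_iff₀ hb]
    exact h2.trans h1
  set P := Measure.pi fun _ : Fin N => μ
  have hmiss : ∀ y ∈ t, P.real (Set.univ.pi fun _ => (Metric.ball y s)ᶜ) ≤
      Real.exp (-(N * m)) := by
    intro y hy
    have h0 : μ.real (Metric.ball y s)ᶜ ≤ Real.exp (-m) := by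
      rw [probReal_compl_eq_one_sub Metric.isOpen_ball.measurableSet]
      linarith [hball y (htΩ y hy), Real.one_sub_le_exp_neg m]
    have h1 : P.real (Set.univ.pi fun _ => (Metric.ball y s)ᶜ) =
        μ.real (Metric.ball y s)ᶜ ^ N := by
      simp [P, Measure.real, Measure.pi_pi]
    rw [h1, ← mul_neg, Real.exp_nat_mul]
    exact pow_le_pow_left₀ measureReal_nonneg h0 N
  have hbad : P.real (⋃ y ∈ t, Set.univ.pi fun _ => (Metric.ball y s)ᶜ) ≤
      b⁻¹ * Real.exp (-(N * m)) := by
    refine (measureReal_biUnion_finset_le t _).trans ((Finset.sum_le_sum hmiss).trans ?_)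
    rw [Finset.sum_const, nsmul_eq_mul]
    gcongr
  have huniv : (Set.univ : Set (Fin N → X)) ⊆
      (⋃ y ∈ t, Set.univ.pi fun _ => (Metric.ball y s)ᶜ) ∪
        {x | ∀ x' ∈ Ω, ∃ i, dist x' (x i) ≤ 2 * s} := by
    intro x _
    rw [Set.mem_union, or_iff_not_imp_left]
    intro hx x' hx'
    obtain ⟨y, hy, hxy⟩ := hcover x' hx'
    simp only [Set.mem_iUnion, Set.mem_pi, Set.mem_univ, true_implies, Set.mem_compl_iff,
      Metric.mem_ball, not_exists, not_forall, not_not] at hx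
    obtain ⟨i, hi⟩ := hx y hy
    exact ⟨i, by linarith [dist_triangle_right x' (x i) y]⟩
  have h1 : 1 ≤ P.real _ := (probReal_univ (μ := P)).symm.le.trans (measureReal_mono huniv)
  linarith [measureReal_union_le (μ := P) (⋃ y ∈ t, Set.univ.pi fun _ => (Metric.ball y s)ᶜ)
    {x | ∀ x' ∈ Ω, ∃ i, dist x' (x i) ≤ 2 * s}]

theorem half_le_log_div {N : ℕ} (hN : 2 ≤ N) {δ : ℝ} (hδ : 0 < δ) (hδ1 : δ < 1) :
    1 / 2 ≤ Real.log (N / δ) := by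
  have hN' : (2 : ℝ) ≤ N := by exact_mod_cast hN
  have : (2 : ℝ) ≤ N / δ := by rw [le_div_iff₀ hδ]; nlinarith
  linarith [Real.log_two_gt_d9, Real.log_le_log two_pos this]

theorem packing_mul_exp_le {d N : ℕ} (hN : 2 ≤ N) {δ m : ℝ} (hδ : 0 < δ) (hδ1 : δ < 1)
    (hm : N * m = (d + 2 : ℕ) * Real.log (N / δ)) :
    (m / 2 ^ d)⁻¹ * Real.exp (-(N * m)) ≤ δ := by
  have hN' : (2 : ℝ) ≤ N := by exact_mod_cast hN
  have hN0 : (0 : ℝ) < N := by linarith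
  have hL := half_le_log_div hN hδ hδ1
  have hNm : 1 ≤ N * m := by
    rw [hm]; push_cast
    nlinarith [(Nat.cast_nonneg d : (0 : ℝ) ≤ d)]
  have hm0 : 0 < m := pos_of_mul_pos_right (by linarith) hN0.le
  have hexp : Real.exp (-(N * m)) = (δ / N) ^ (d + 2) := by
    rw [hm, ← mul_neg, Real.exp_nat_mul, Real.exp_neg, Real.exp_log (by positivity), inv_div]
  have hu : δ / N ≤ 1 / 2 := by rw [div_le_div_iff₀ hN0 two_pos]; linarith
  have hpow : (δ / N) ^ (d + 2) ≤ (1 / 2) ^ (d + 1) * (δ / N) := by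
    rw [pow_succ]
    gcongr
  have hm1 : m⁻¹ ≤ N := by rwa [inv_le_iff_one_le_mul₀ hm0]
  calc (m / 2 ^ d)⁻¹ * Real.exp (-(N * m)) = 2 ^ d * m⁻¹ * (δ / N) ^ (d + 2) := by
        rw [hexp, inv_div, div_eq_mul_inv]
    _ ≤ 2 ^ d * N * ((1 / 2) ^ (d + 1) * (δ / N)) := by gcongr
    _ = δ / 2 := by
        rw [one_div, inv_pow]
        field_simp
        ring
    _ ≤ δ := by linarith

/-- High-probability fill-distance bound for i.i.d. uniform samples from a
compact domain `Ω ⊆ ℝ^d` satisfying an interior cone-type volume condition. -/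
theorem fill_distance_bound_uniform_domain
    {d : ℕ} (hd : 1 ≤ d) (Ω : Set (EuclideanSpace ℝ (Fin d)))
    (hΩc : IsCompact Ω) (hΩvol : 0 < volume Ω)
    (c r₀ : ℝ) (hc : 0 < c) (hr₀ : 0 < r₀)
    (hball : ∀ x ∈ Ω, ∀ r : ℝ, 0 < r → r < r₀ →
      ENNReal.ofReal (c * r ^ d) ≤ volume (Ω ∩ Metric.ball x r)) :
    ∃ C : ℝ, 0 < C ∧ ∀ N : ℕ, 2 ≤ N → ∀ δ : ℝ, 0 < δ → δ < 1 →
      ENNReal.ofReal (1 - δ) ≤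
        (Measure.pi fun _ : Fin N => (volume Ω)⁻¹ • volume.restrict Ω)
          {x : Fin N → EuclideanSpace ℝ (Fin d) |
            ∀ x' ∈ Ω, ∃ i : Fin N,
              dist x' (x i) ≤ C * (Real.log ((N : ℝ) / δ) / (N : ℝ)) ^ ((1 : ℝ) / d)} := by
  have hΩtop : volume Ω ≠ ⊤ := hΩc.measure_lt_top.ne
  set μ := (volume Ω)⁻¹ • volume.restrict Ω with hμ
  have hμapp (A : Set (EuclideanSpace ℝ (Fin d))) (hA : MeasurableSet A) :
      μ.real A = (volume.real Ω)⁻¹ * volume.real (Ω ∩ A) := by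
    simp [hμ, Measure.real, Measure.restrict_apply hA, Set.inter_comm]
  have hμΩ : μ Ω = 1 := by
    simp [hμ, ENNReal.inv_mul_cancel hΩvol.ne' hΩtop]
  have : IsProbabilityMeasure μ :=
    ⟨by simp [hμ, ENNReal.inv_mul_cancel hΩvol.ne' hΩtop]⟩
  have hV : 0 < volume.real Ω := ENNReal.toReal_pos hΩvol.ne' hΩtop
  set κ := c / volume.real Ω with hκ
  have hκ0 : 0 < κ := by positivity
  have hmass : ∀ x ∈ Ω, ∀ r : ℝ, 0 < r → r < r₀ → κ * r ^ d ≤ μ.real (Metric.ball x r) := by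
    intro x hx r hr hr'
    have h := (ENNReal.ofReal_le_iff_le_toReal
      (measure_ne_top_of_subset Set.inter_subset_left hΩtop)).1 (hball x hx r hr hr')
    rw [hμapp _ Metric.isOpen_ball.measurableSet, hκ, div_eq_inv_mul, mul_assoc]
    gcongr
    exact h
  set a := (((d + 2 : ℕ) : ℝ) / κ) ^ ((1 : ℝ) / d) with ha
  have ha0 : 0 < a := by positivity
  refine ⟨2 * a + Metric.diam Ω * a / r₀, by positivity, fun N hN δ hδ hδ1 => ?_⟩
  have hN0 : (0 : ℝ) < N := by positivity
  have hL := half_le_log_div hN hδ hδ1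
  set ρ := (Real.log ((N : ℝ) / δ) / (N : ℝ)) ^ ((1 : ℝ) / d) with hρ
  have hquot : 0 < Real.log ((N : ℝ) / δ) / N := div_pos (by linarith) hN0
  have hρ0 : 0 < ρ := by positivity
  have hd0 : d ≠ 0 := by omega
  have hpow : κ * (a * ρ) ^ d = (d + 2 : ℕ) * Real.log (N / δ) / N := by
    rw [mul_pow, ha, hρ, one_div, Real.rpow_inv_natCast_pow (by positivity) hd0,
      Real.rpow_inv_natCast_pow hquot.le hd0]
    field_simp
  rcases lt_or_ge (a * ρ) r₀ with hlt | hge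
  · have hs : 0 < a * ρ := by positivity
    have key := one_sub_le_measureReal_pi_dense μ hΩc.totallyBounded hs
      (b := κ * (a * ρ) ^ d / 2 ^ d) (by positivity)
      (fun x hx => by
        rw [mul_div_assoc, ← div_pow]
        exact hmass x hx _ (by positivity) (by linarith))
      (fun x hx => hmass x hx _ hs hlt) N
    have hδb := packing_mul_exp_le (d := d) (m := κ * (a * ρ) ^ d) hN hδ hδ1
      (by rw [hpow]; field_simp)
    refine ENNReal.ofReal_le_of_le_toReal (((sub_le_sub_left hδb 1).trans key).trans
      (measureReal_mono fun x hx x' hx' => ?_))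
    obtain ⟨i, hi⟩ := hx x' hx'
    refine ⟨i, hi.trans ?_⟩
    rw [add_mul, ← mul_assoc]
    exact le_add_of_nonneg_right (by positivity)
  · have hfull : (Measure.pi fun _ : Fin N => μ) (Set.univ.pi fun _ => Ω) = 1 := by
      simp [Measure.pi_pi, hμΩ]
    refine (ENNReal.ofReal_le_one.2 (by linarith)).trans (hfull.symm.le.trans
      (measure_mono fun x hx x' hx' => ⟨⟨0, by omega⟩, ?_⟩))
    refine (Metric.dist_le_diam_of_mem hΩc.isBounded hx' (hx _ (Set.mem_univ _))).trans ?_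
    have h1 : Metric.diam Ω ≤ Metric.diam Ω * ((a * ρ) / r₀) :=
      le_mul_of_one_le_right Metric.diam_nonneg ((one_le_div hr₀).2 hge)
    calc Metric.diam Ω ≤ Metric.diam Ω * a / r₀ * ρ := by convert h1 using 1; ring
      _ ≤ (2 * a + Metric.diam Ω * a / r₀) * ρ := by
        gcongr
        linarith
end

section
/- Let (E, dist) be a metric space, M ⊆ E a nonempty compact subset, and μ a Borel probability measure on E with μ(E ∖ M) = 0. Let q > 0 and suppose there exist constants c > 0 and r₀ > 0 such that μ(B(x, r)) ≥ c·r^q for every x ∈ M and every r ∈ (0, r₀). Then there exists a constant C > 0, independent of the number of samples and of the confidence level, such that for every integer N ≥ 2 and every δ ∈ (0, 1), the product measure μ^{⊗N} of the set of N-tuples (x₁, …, x_N) ∈ E^N whose fill distance satisfies h_M(x₁, …, x_N) ≤ C·(log(N/δ)/N)^{1/q} is at least 1 − δ. -/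
open MeasureTheory

open Metric in
/-- A totally bounded set contains, for each `r > 0`, a finite subset with pairwise distances
larger than `r` that meets every closed ball of radius `r` centred in the set. -/
lemma TotallyBounded.exists_finset_separated_cover {E : Type*} [PseudoMetricSpace E] {M : Set E}
    (hM : TotallyBounded M) {r : ℝ} (hr : 0 < r) :
    ∃ Z : Finset E, (∀ z ∈ Z, z ∈ M) ∧ (∀ z ∈ Z, ∀ w ∈ Z, z ≠ w → r < dist z w) ∧
      ∀ x ∈ M, ∃ z ∈ Z, dist x z ≤ r := by
  obtain ⟨ε, rfl⟩ : ∃ ε : NNReal, r = ((2 * ε : NNReal) : ℝ) :=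
    ⟨(r / 2).toNNReal, by rw [NNReal.coe_mul, Real.coe_toNNReal _ (by positivity)]; simp; ring⟩
  have hε : ε ≠ 0 := by
    rintro rfl
    simp at hr
  obtain ⟨T, -, hTfin, hT⟩ := exists_finite_isCover_of_totallyBounded hε hM
  have htop : packingNumber (2 * ε) M ≠ ⊤ := ne_top_of_le_ne_top hTfin.encard_lt_top.ne
    ((packingNumber_two_mul_le_externalCoveringNumber ε M).trans
      hT.externalCoveringNumber_le_encard)
  obtain ⟨Z, hZ⟩ : ∃ Z : Finset E, (Z : Set E) = maximalSeparatedSet (2 * ε) M :=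
    Set.Finite.exists_finset_coe <| Set.encard_ne_top_iff.mp <| by
      rwa [encard_maximalSeparatedSet htop]
  refine ⟨Z, fun z hz ↦ ?_, fun z hz w hw hzw ↦ ?_, fun x hx ↦ ?_⟩
  · exact maximalSeparatedSet_subset (hZ ▸ Finset.mem_coe.2 hz)
  · have h := isSeparated_maximalSeparatedSet (ε := 2 * ε) (A := M)
      (hZ ▸ Finset.mem_coe.2 hz) (hZ ▸ Finset.mem_coe.2 hw) hzw
    beta_reduce at h
    rw [edist_nndist, ENNReal.coe_lt_coe] at h
    exact_mod_cast h
  · obtain ⟨z, hz, h⟩ := isCover_maximalSeparatedSet htop hx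
    refine ⟨z, Finset.mem_coe.1 (hZ ▸ hz), ?_⟩
    change edist x z ≤ _ at h
    rw [edist_nndist, ENNReal.coe_le_coe] at h
    exact_mod_cast h

/-- The cardinality of an `r`-separated finite set is controlled by a lower bound on the mass of
balls of radius `r / 2` centred at its points. -/
lemma Finset.card_mul_le_one_of_separated {E : Type*} [PseudoMetricSpace E] [MeasurableSpace E]
    [OpensMeasurableSpace E] (μ : Measure E) [IsProbabilityMeasure μ] (Z : Finset E) {r p : ℝ}
    (hsep : ∀ z ∈ Z, ∀ w ∈ Z, z ≠ w → r < dist z w)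
    (hp : ∀ z ∈ Z, ENNReal.ofReal p ≤ μ (Metric.ball z (r / 2))) :
    (Z.card : ℝ) * p ≤ 1 := by
  have hdisj : (Z : Set E).PairwiseDisjoint fun z ↦ Metric.ball z (r / 2) :=
    fun z hz w hw hzw ↦ Metric.ball_disjoint_ball (by linarith [hsep z hz w hw hzw])
  have h : ENNReal.ofReal (Z.card * p) ≤ 1 := by
    calc ENNReal.ofReal (Z.card * p) = ∑ z ∈ Z, ENNReal.ofReal p := by
          rw [ENNReal.ofReal_mul (by positivity)]
          simp
      _ ≤ ∑ z ∈ Z, μ (Metric.ball z (r / 2)) := Finset.sum_le_sum hp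
      _ = μ (⋃ z ∈ Z, Metric.ball z (r / 2)) :=
          (measure_biUnion_finset hdisj fun _ _ ↦ measurableSet_ball).symm
      _ ≤ 1 := prob_le_one
  exact ENNReal.ofReal_le_one.1 h

/-- The probability that `N` independent samples all miss a set of mass at least `p` is at most
`exp (-(N * p))`. -/
lemma MeasureTheory.Measure.pi_forall_notMem_le_exp {E : Type*} [MeasurableSpace E]
    (μ : Measure E) [IsProbabilityMeasure μ] (N : ℕ) {B : Set E} (hB : MeasurableSet B) {p : ℝ}
    (hp₀ : 0 ≤ p) (hp : ENNReal.ofReal p ≤ μ B) :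
    (Measure.pi fun _ : Fin N ↦ μ) {x | ∀ i, x i ∉ B} ≤ ENNReal.ofReal (Real.exp (-(N * p))) := by
  have hset : {x : Fin N → E | ∀ i, x i ∉ B} = Set.univ.pi fun _ ↦ Bᶜ := by
    ext x
    simp
  have hcompl : μ Bᶜ ≤ ENNReal.ofReal (Real.exp (-p)) := by
    rw [prob_compl_eq_one_sub hB]
    calc 1 - μ B ≤ 1 - ENNReal.ofReal p := tsub_le_tsub_left hp 1
      _ = ENNReal.ofReal (1 - p) := by rw [ENNReal.ofReal_sub _ hp₀, ENNReal.ofReal_one]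
      _ ≤ ENNReal.ofReal (Real.exp (-p)) :=
          ENNReal.ofReal_le_ofReal (Real.one_sub_le_exp_neg p)
  rw [hset, Measure.pi_pi, Finset.prod_const, Finset.card_univ, Fintype.card_fin]
  calc μ Bᶜ ^ N ≤ ENNReal.ofReal (Real.exp (-p)) ^ N := by gcongr
    _ = ENNReal.ofReal (Real.exp (-(N * p))) := by
        rw [← ENNReal.ofReal_pow (Real.exp_nonneg _), ← Real.exp_nat_mul, mul_neg]

/-- If balls of radius `r / 2` and `r` centred in `M` have mass at least `p'` and `p`, then `N`
independent samples fail to be `2 * r`-dense in `M` with probability at most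
`exp (-(N * p)) / p'`. -/
lemma TotallyBounded.pi_exists_dist_gt_le {E : Type*} [PseudoMetricSpace E] [MeasurableSpace E]
    [OpensMeasurableSpace E] {M : Set E} (hM : TotallyBounded M) (μ : Measure E)
    [IsProbabilityMeasure μ] (N : ℕ) {r p p' : ℝ} (hr : 0 < r) (hp₀ : 0 ≤ p) (hp'₀ : 0 < p')
    (hp : ∀ x ∈ M, ENNReal.ofReal p ≤ μ (Metric.ball x r))
    (hp' : ∀ x ∈ M, ENNReal.ofReal p' ≤ μ (Metric.ball x (r / 2))) :
    (Measure.pi fun _ : Fin N ↦ μ) {x | ∃ x' ∈ M, ∀ i, 2 * r < dist x' (x i)} ≤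
      ENNReal.ofReal (Real.exp (-(N * p)) / p') := by
  obtain ⟨Z, hZM, hsep, hcov⟩ := hM.exists_finset_separated_cover hr
  have hcard : (Z.card : ℝ) ≤ 1 / p' := by
    rw [le_div_iff₀ hp'₀]
    exact Z.card_mul_le_one_of_separated μ hsep fun z hz ↦ hp' z (hZM z hz)
  have hsub : {x : Fin N → E | ∃ x' ∈ M, ∀ i, 2 * r < dist x' (x i)} ⊆
      ⋃ z ∈ Z, {x | ∀ i, x i ∉ Metric.ball z r} := by
    rintro x ⟨x', hx', hx⟩
    obtain ⟨z, hz, hxz⟩ := hcov x' hx'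
    simp only [Set.mem_iUnion]
    refine ⟨z, hz, fun i hi ↦ ?_⟩
    rw [Metric.mem_ball'] at hi
    linarith [hx i, dist_triangle x' z (x i)]
  calc (Measure.pi fun _ : Fin N ↦ μ) {x | ∃ x' ∈ M, ∀ i, 2 * r < dist x' (x i)}
      ≤ ∑ z ∈ Z, (Measure.pi fun _ : Fin N ↦ μ) {x | ∀ i, x i ∉ Metric.ball z r} :=
        (measure_mono hsub).trans (measure_biUnion_finset_le Z _)
    _ ≤ ∑ z ∈ Z, ENNReal.ofReal (Real.exp (-(N * p))) := Finset.sum_le_sum fun z hz ↦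
        Measure.pi_forall_notMem_le_exp μ N measurableSet_ball hp₀ (hp z (hZM z hz))
    _ = ENNReal.ofReal (Z.card * Real.exp (-(N * p))) := by
        rw [ENNReal.ofReal_mul (by positivity)]
        simp
    _ ≤ ENNReal.ofReal (Real.exp (-(N * p)) / p') := by
        refine ENNReal.ofReal_le_ofReal ?_
        calc Z.card * Real.exp (-(N * p)) ≤ 1 / p' * Real.exp (-(N * p)) := by gcongr
          _ = Real.exp (-(N * p)) / p' := by ring

/-- A set whose complement has (outer) probability at most `δ` has probability at least
`1 - δ`. -/
lemma MeasureTheory.ofReal_one_sub_le_of_measure_compl_le {Ω : Type*} [MeasurableSpace Ω]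
    (P : Measure Ω) [IsProbabilityMeasure P] {S : Set Ω} {δ : ℝ} (hδ : 0 ≤ δ)
    (h : P Sᶜ ≤ ENNReal.ofReal δ) : ENNReal.ofReal (1 - δ) ≤ P S := by
  rw [ENNReal.ofReal_sub _ hδ, ENNReal.ofReal_one, tsub_le_iff_right]
  calc (1 : ENNReal) = P (S ∪ Sᶜ) := by rw [Set.union_compl_self, measure_univ]
    _ ≤ P S + P Sᶜ := measure_union_le _ _
    _ ≤ P S + ENNReal.ofReal δ := by gcongr

/-- High-probability fill-distance bound for i.i.d. samples from a measure
supported on a compact subset `M` of a metric space, under a `c·r^q` lower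
bound on the measure of small balls. -/
theorem fill_distance_bound_metric
    {E : Type*} [MetricSpace E] [MeasurableSpace E] [BorelSpace E]
    (M : Set E) (hMc : IsCompact M) (hMne : M.Nonempty)
    (μ : Measure E) [IsProbabilityMeasure μ] (hsupp : μ Mᶜ = 0)
    (q : ℝ) (hq : 0 < q)
    (c r₀ : ℝ) (hc : 0 < c) (hr₀ : 0 < r₀)
    (hball : ∀ x ∈ M, ∀ r : ℝ, 0 < r → r < r₀ →
      ENNReal.ofReal (c * r ^ q) ≤ μ (Metric.ball x r)) :
    ∃ C : ℝ, 0 < C ∧ ∀ N : ℕ, 2 ≤ N → ∀ δ : ℝ, 0 < δ → δ < 1 →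
      ENNReal.ofReal (1 - δ) ≤
        (Measure.pi fun _ : Fin N => μ)
          {x : Fin N → E |
            ∀ x' ∈ M, ∃ i : Fin N,
              dist x' (x i) ≤ C * (Real.log ((N : ℝ) / δ) / (N : ℝ)) ^ ((1 : ℝ) / q)} := by
  have hlog2 : 0 < Real.log 2 := Real.log_pos one_lt_two
  obtain ⟨A, hA⟩ : ∃ A : ℝ, A = 2 ^ q / (c * Real.log 2) := ⟨_, rfl⟩
  have hA₀ : 0 < A := hA ▸ by positivity
  have hcA : c * A * Real.log 2 = 2 ^ q := by rw [hA]; field_simp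
  have hcA₁ : 1 ≤ c * A := by
    have h1 : (1 : ℝ) ≤ 2 ^ q := Real.one_le_rpow one_le_two hq.le
    have h2 : Real.log 2 ≤ 1 := by linarith [Real.log_two_lt_d9]
    nlinarith [mul_pos hc hA₀]
  obtain ⟨a, ha⟩ : ∃ a : ℝ, a = A ^ (1 / q) := ⟨_, rfl⟩
  have ha₀ : 0 < a := ha ▸ by positivity
  have haq : a ^ q = A := by
    rw [ha, ← Real.rpow_mul hA₀.le, one_div_mul_cancel hq.ne', Real.rpow_one]
  have hD : 0 ≤ Metric.diam M := Metric.diam_nonneg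
  refine ⟨2 * a + a * Metric.diam M / r₀, by positivity, fun N hN δ hδ₀ hδ₁ ↦ ?_⟩
  have hN' : (2 : ℝ) ≤ N := by exact_mod_cast hN
  have hN₀ : (0 : ℝ) < N := by linarith
  obtain ⟨L, hL⟩ : ∃ L : ℝ, L = Real.log (N / δ) := ⟨_, rfl⟩
  have hL2 : Real.log 2 ≤ L := by
    rw [hL]
    refine Real.log_le_log two_pos ?_
    rw [le_div_iff₀ hδ₀]
    nlinarith
  have hL₀ : 0 < L := hlog2.trans_le hL2
  obtain ⟨ε, hε⟩ : ∃ ε : ℝ, ε = (L / N) ^ (1 / q) := ⟨_, rfl⟩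
  have hε₀ : 0 < ε := hε ▸ by positivity
  have hεq : ε ^ q = L / N := by
    rw [hε, ← Real.rpow_mul (by positivity), one_div_mul_cancel hq.ne', Real.rpow_one]
  rw [← hL, ← hε]
  refine ofReal_one_sub_le_of_measure_compl_le _ hδ₀.le ?_
  have hr : 0 < a * ε := by positivity
  rcases lt_or_ge (a * ε) r₀ with hlt | hge
  · have hrq : (a * ε) ^ q = A * (L / N) := by
      rw [Real.mul_rpow ha₀.le hε₀.le, haq, hεq]
    have hrq' : (a * ε / 2) ^ q = A * (L / N) / 2 ^ q := by
      rw [Real.div_rpow hr.le zero_le_two, hrq]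
    refine (measure_mono fun x hx ↦ ?_).trans
      ((hMc.totallyBounded.pi_exists_dist_gt_le μ N hr (p := c * (A * (L / N)))
        (p' := c * (A * (L / N) / 2 ^ q)) (by positivity) (by positivity)
        (fun x hx ↦ hrq ▸ hball x hx _ hr hlt)
        (fun x hx ↦ hrq' ▸ hball x hx _ (by positivity) (by linarith))).trans
        (ENNReal.ofReal_le_ofReal ?_))
    · simp only [Set.mem_compl_iff, Set.mem_ofPred_eq] at hx ⊢
      push Not at hx
      obtain ⟨x', hx', h⟩ := hx
      refine ⟨x', hx', fun i ↦ lt_of_le_of_lt ?_ (h i)⟩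
      have : 0 ≤ a * Metric.diam M / r₀ * ε := by positivity
      linarith
    · have hexp : Real.exp (-(N * (c * (A * (L / N))))) ≤ δ / N := by
        calc Real.exp (-(N * (c * (A * (L / N))))) = Real.exp (-(c * A * L)) := by
              congr 2
              field_simp
          _ ≤ Real.exp (-L) := by
              refine Real.exp_le_exp.2 (neg_le_neg ?_)
              nlinarith
          _ = δ / N := by rw [Real.exp_neg, hL, Real.exp_log (by positivity), inv_div]
      have hp' : 1 / N ≤ c * (A * (L / N) / 2 ^ q) := by
        have h : 2 ^ q ≤ c * A * L := by
          rw [← hcA]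
          gcongr
        rw [show c * (A * (L / N) / 2 ^ q) = c * A * L / 2 ^ q / N by ring]
        gcongr
        rwa [one_le_div (by positivity)]
      rw [div_le_iff₀ (by positivity)]
      calc Real.exp (-(N * (c * (A * (L / N))))) ≤ δ * (1 / N) := by rwa [mul_one_div]
        _ ≤ δ * (c * (A * (L / N) / 2 ^ q)) := by gcongr
  · have hnull : (Measure.pi fun _ : Fin N ↦ μ)
        (Function.eval (⟨0, by omega⟩ : Fin N) ⁻¹' Mᶜ) = 0 :=
      Measure.pi_eval_preimage_null (fun _ : Fin N ↦ μ) hsupp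
    refine (measure_mono ?_).trans (hnull.le.trans zero_le)
    intro x hx hxM
    refine hx fun x' hx' ↦ ⟨⟨0, by omega⟩, ?_⟩
    have h1 : Metric.diam M ≤ a * Metric.diam M / r₀ * ε := by
      rw [div_mul_eq_mul_div, le_div_iff₀ hr₀]
      nlinarith
    have h2 := Metric.dist_le_diam_of_mem hMc.isBounded hx' hxM
    nlinarith
end

section
/- Let (E, dist) be a metric space, M ⊆ E a nonempty compact subset, and μ a Borel probability measure on E with μ(E ∖ M) = 0. Let Φ : (0, ∞) → [0, ∞) be a continuous, strictly increasing function with Φ(r) → 0 as r → 0⁺, and suppose there exists r₀ > 0 such that μ(B(x, r)) ≥ Φ(r) for every x ∈ M and every r ∈ (0, r₀). Then there exist positive constants c₁, c₂, c₃ and α₀ such that for every α > α₀ and every integer N ≥ 2, the product measure μ^{⊗N} of the set of N-tuples (x₁, …, x_N) ∈ E^N such that h_M(x₁, …, x_N) > 0 and Φ(h_M(x₁, …, x_N)/c₁) ≥ α·log(N)/N is at most c₂·N^{1 − c₃α}. -/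
open MeasureTheory

/-- The fill distance of the points `x 0, …, x (N-1)` in the set `M`:
`h_M(x) = sup_{x' ∈ M} min_i dist (x', x i)`. -/
noncomputable def fillDist {E : Type*} [MetricSpace E] {N : ℕ}
    (M : Set E) (x : Fin N → E) : ℝ :=
  ⨆ x' : M, ⨅ i : Fin N, dist (x' : E) (x i)

/-- If every ball of radius `s` centered in a compact set `M` has measure at least `c`, then `M` is
covered by `k` balls of radius `2 * s` centered in `M`, where `k * c ≤ 1`. -/
theorem exists_finset_cover_card_mul_le_one
    {E : Type*} [MetricSpace E] [MeasurableSpace E] [BorelSpace E]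
    {M : Set E} (hM : IsCompact M) (μ : Measure E) [IsProbabilityMeasure μ]
    {s : ℝ} (hs : 0 < s) {c : ENNReal} (hc : ∀ x ∈ M, c ≤ μ (Metric.ball x s)) :
    ∃ T : Finset E, (T : Set E) ⊆ M ∧ (∀ x ∈ M, ∃ y ∈ T, dist x y ≤ 2 * s) ∧
      (T.card : ENNReal) * c ≤ 1 := by
  lift s to NNReal using hs.le
  have hs' : s ≠ 0 := by rintro rfl; simp at hs
  have hpack : Metric.packingNumber (2 * s) M ≠ ⊤ := by
    obtain ⟨C, -, hCfin, hC⟩ := Metric.exists_finite_isCover_of_isCompact hs' hM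
    exact ne_top_of_le_ne_top (Set.encard_ne_top_iff.2 hCfin)
      ((Metric.packingNumber_two_mul_le_externalCoveringNumber s M).trans
        hC.externalCoveringNumber_le_encard)
  have hfin : (Metric.maximalSeparatedSet (2 * s) M).Finite := by
    rw [← Set.encard_ne_top_iff, Metric.encard_maximalSeparatedSet hpack]
    exact hpack
  have hsub : (hfin.toFinset : Set E) ⊆ M := by
    rw [hfin.coe_toFinset]
    exact Metric.maximalSeparatedSet_subset
  refine ⟨hfin.toFinset, hsub, fun x hx => ?_, ?_⟩
  · have h := (Metric.isCover_maximalSeparatedSet hpack).subset_iUnion_closedBall hx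
    simpa using h
  · have hdisj : (hfin.toFinset : Set E).PairwiseDisjoint fun y => Metric.ball y (s : ℝ) := by
      rw [hfin.coe_toFinset]
      intro y hy z hz hyz
      apply Metric.ball_disjoint_ball
      have h : ((2 * s : NNReal) : ENNReal) < edist y z :=
        Metric.isSeparated_maximalSeparatedSet hy hz hyz
      rw [edist_nndist, ENNReal.coe_lt_coe, ← NNReal.coe_lt_coe, coe_nndist] at h
      push_cast at h
      linarith
    calc (hfin.toFinset.card : ENNReal) * c = ∑ _y ∈ hfin.toFinset, c := by simp
      _ ≤ ∑ y ∈ hfin.toFinset, μ (Metric.ball y s) :=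
        Finset.sum_le_sum fun y hy => hc y (hsub hy)
      _ = μ (⋃ y ∈ hfin.toFinset, Metric.ball y s) :=
        (measure_biUnion_finset hdisj fun _ _ => Metric.isOpen_ball.measurableSet).symm
      _ ≤ 1 := prob_le_one

theorem exists_forall_lt_dist_of_lt_fillDist {E : Type*} [MetricSpace E] {N : ℕ} {M : Set E}
    (hM : M.Nonempty) {x : Fin N → E} {r : ℝ} (h : r < fillDist M x) :
    ∃ z ∈ M, ∀ i, r < dist z (x i) := by
  have := hM.to_subtype
  obtain ⟨z, hz⟩ := exists_lt_of_lt_ciSup h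
  exact ⟨z, z.2, fun i => hz.trans_le (ciInf_le (Set.finite_range _).bddBelow i)⟩

theorem fillDist_le_diam {E : Type*} [MetricSpace E] {N : ℕ} [NeZero N] {M : Set E}
    (hM : Bornology.IsBounded M) {x : Fin N → E} (hx : ∀ i, x i ∈ M) :
    fillDist M x ≤ Metric.diam M :=
  Real.iSup_le (fun z => (ciInf_le (Set.finite_range _).bddBelow 0).trans
    (Metric.dist_le_diam_of_mem hM z.2 (hx 0))) Metric.diam_nonneg

/-- If every ball of radius `s` centered in a compact set `M` has measure at least `c`, then the
fill distance of `N` independent samples exceeds `3 * s` with probability at most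
`c⁻¹ * (1 - c) ^ N`. -/
theorem measure_pi_lt_fillDist_le
    {E : Type*} [MetricSpace E] [MeasurableSpace E] [BorelSpace E]
    {M : Set E} (hM : IsCompact M) (hMne : M.Nonempty) (μ : Measure E) [IsProbabilityMeasure μ]
    {s : ℝ} (hs : 0 < s) {c : ENNReal}
    (hc : ∀ x ∈ M, c ≤ μ (Metric.ball x s)) (N : ℕ) :
    (Measure.pi fun _ : Fin N => μ) {x | 3 * s < fillDist M x} ≤ c⁻¹ * (1 - c) ^ N := by
  obtain ⟨T, hTM, hTcov, hTcard⟩ := exists_finset_cover_card_mul_le_one hM μ hs hc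
  have hsub : {x : Fin N → E | 3 * s < fillDist M x} ⊆
      ⋃ y ∈ T, Set.univ.pi fun _ : Fin N => (Metric.ball y s)ᶜ := by
    intro x hx
    obtain ⟨z, hzM, hz⟩ := exists_forall_lt_dist_of_lt_fillDist hMne hx
    obtain ⟨y, hyT, hy⟩ := hTcov z hzM
    refine Set.mem_biUnion hyT fun i _ => ?_
    rw [Set.mem_compl_iff, Metric.mem_ball, not_lt, dist_comm]
    linarith [hz i, dist_triangle z y (x i)]
  calc (Measure.pi fun _ : Fin N => μ) {x | 3 * s < fillDist M x}
      ≤ ∑ y ∈ T, (Measure.pi fun _ : Fin N => μ)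
          (Set.univ.pi fun _ : Fin N => (Metric.ball y s)ᶜ) :=
        (measure_mono hsub).trans (measure_biUnion_finset_le _ _)
    _ ≤ ∑ _y ∈ T, (1 - c) ^ N := by
        refine Finset.sum_le_sum fun y hy => ?_
        rw [Measure.pi_pi, Finset.prod_const, Finset.card_univ, Fintype.card_fin,
          prob_compl_eq_one_sub Metric.isOpen_ball.measurableSet]
        gcongr
        exact hc y (hTM hy)
    _ = T.card * (1 - c) ^ N := by simp
    _ ≤ c⁻¹ * (1 - c) ^ N := by
        gcongr
        exact ENNReal.le_inv_iff_mul_le.2 hTcard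

theorem inv_mul_one_sub_pow_le_rpow {α : ℝ} (hα : 1 ≤ α) {N : ℕ} (hN : 2 ≤ N)
    (h1 : α * Real.log N / N ≤ 1) :
    (α * Real.log N / N)⁻¹ * (1 - α * Real.log N / N) ^ N ≤
      (Real.log 2)⁻¹ * (N : ℝ) ^ (1 - α) := by
  have hN2 : (2 : ℝ) ≤ N := by exact_mod_cast hN
  have hN0 : (0 : ℝ) < N := by linarith
  have hlog2 : 0 < Real.log 2 := Real.log_pos one_lt_two
  have hlog : Real.log 2 ≤ α * Real.log N := by
    have := Real.log_le_log two_pos hN2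
    nlinarith
  have hexp : (1 - α * Real.log N / N) ^ N ≤ (N : ℝ) ^ (-α) := by
    refine (Real.one_sub_div_pow_le_exp_neg ((div_le_one hN0).1 h1)).trans_eq ?_
    rw [Real.rpow_def_of_pos hN0]
    ring_nf
  calc (α * Real.log N / N)⁻¹ * (1 - α * Real.log N / N) ^ N
      ≤ ((Real.log 2)⁻¹ * N) * (N : ℝ) ^ (-α) := by
        rw [inv_div, div_eq_inv_mul]
        gcongr
    _ = (Real.log 2)⁻¹ * (N : ℝ) ^ (1 - α) := by
        rw [sub_eq_add_neg, Real.rpow_add hN0, Real.rpow_one, mul_assoc]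

/-- Covering/fill-distance bound of Reznikov–Saff type: if small balls centered
on `M` have `μ`-measure at least `Φ(r)`, then the fill distance of `N` i.i.d.
samples exceeds `c₁·Φ⁻¹(α log N / N)` with probability at most `c₂·N^{1-c₃α}`. -/
theorem fill_distance_tail_bound
    {E : Type*} [MetricSpace E] [MeasurableSpace E] [BorelSpace E]
    (M : Set E) (hMc : IsCompact M) (hMne : M.Nonempty)
    (μ : Measure E) [IsProbabilityMeasure μ] (hsupp : μ Mᶜ = 0)
    (Φ : ℝ → ℝ)
    (hΦcont : ContinuousOn Φ (Set.Ioi (0 : ℝ)))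
    (hΦmono : StrictMonoOn Φ (Set.Ioi (0 : ℝ)))
    (hΦnonneg : ∀ r : ℝ, 0 < r → 0 ≤ Φ r)
    (hΦ0 : Filter.Tendsto Φ (nhdsWithin 0 (Set.Ioi 0)) (nhds 0))
    (r₀ : ℝ) (hr₀ : 0 < r₀)
    (hball : ∀ x ∈ M, ∀ r : ℝ, 0 < r → r < r₀ →
      ENNReal.ofReal (Φ r) ≤ μ (Metric.ball x r)) :
    ∃ c₁ c₂ c₃ α₀ : ℝ, 0 < c₁ ∧ 0 < c₂ ∧ 0 < c₃ ∧ 0 < α₀ ∧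
      ∀ α : ℝ, α₀ < α → ∀ N : ℕ, 2 ≤ N →
        (Measure.pi fun _ : Fin N => μ)
          {x : Fin N → E | 0 < fillDist M x ∧
            α * Real.log (N : ℝ) / (N : ℝ) ≤ Φ (fillDist M x / c₁)} ≤
        ENNReal.ofReal (c₂ * (N : ℝ) ^ (1 - c₃ * α)) := by
  have hD : 0 ≤ Metric.diam M := Metric.diam_nonneg
  have hc₁ : 0 < 4 + Metric.diam M / r₀ := by positivity
  refine ⟨4 + Metric.diam M / r₀, (Real.log 2)⁻¹, 1, 1, hc₁,
    inv_pos.2 (Real.log_pos one_lt_two), one_pos, one_pos, fun α hα N hN => ?_⟩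
  set c₁ := 4 + Metric.diam M / r₀ with hc₁_def
  have : NeZero N := ⟨by omega⟩
  set t := α * Real.log N / N with ht_def
  have ht : 0 < t := by
    have : 0 < Real.log N := Real.log_pos (by exact_mod_cast hN)
    have : (0 : ℝ) < N := by exact_mod_cast (by omega : 0 < N)
    positivity
  have hmem : ∀ᵐ x ∂(Measure.pi fun _ : Fin N => μ), ∀ i, x i ∈ M :=
    ae_all_iff.2 fun i => Measure.tendsto_eval_ae_ae.eventually (mem_ae_iff.2 hsupp)
  have hlt : ∀ x : Fin N → E, (∀ i, x i ∈ M) → fillDist M x / c₁ < r₀ := fun x hx => by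
    have h := fillDist_le_diam hMc.isBounded hx
    rw [div_lt_iff₀ hc₁, hc₁_def, mul_add, mul_div_cancel₀ _ hr₀.ne']
    linarith
  by_cases hex : ∃ s, 0 < s ∧ s < r₀ ∧ Φ s = t
  · obtain ⟨s, hs, hsr, hst⟩ := hex
    have hball' : ∀ x ∈ M, ENNReal.ofReal t ≤ μ (Metric.ball x s) := fun x hx =>
      hst ▸ hball x hx s hs hsr
    have ht1 : t ≤ 1 := by
      obtain ⟨x, hx⟩ := hMne
      exact ENNReal.ofReal_le_one.1 ((hball' x hx).trans prob_le_one)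
    calc _ ≤ (Measure.pi fun _ : Fin N => μ) {x | 3 * s < fillDist M x} := by
          refine measure_mono fun x hx => ?_
          have h : s ≤ fillDist M x / c₁ :=
            (hΦmono.le_iff_le hs (div_pos hx.1 hc₁)).1 (hst.trans_le hx.2)
          rw [le_div_iff₀ hc₁, hc₁_def] at h
          have : 0 ≤ s * (Metric.diam M / r₀) := by positivity
          show 3 * s < fillDist M x
          linarith
      _ ≤ (ENNReal.ofReal t)⁻¹ * (1 - ENNReal.ofReal t) ^ N :=
          measure_pi_lt_fillDist_le hMc hMne μ hs hball' N
      _ = ENNReal.ofReal (t⁻¹ * (1 - t) ^ N) := by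
          rw [ENNReal.ofReal_mul (by positivity), ENNReal.ofReal_inv_of_pos ht,
            ENNReal.ofReal_pow (by linarith), ENNReal.ofReal_sub _ ht.le, ENNReal.ofReal_one]
      _ ≤ _ := by
          rw [one_mul]
          exact ENNReal.ofReal_le_ofReal (inv_mul_one_sub_pow_le_rpow hα.le hN ht1)
  · have hnull : (Measure.pi fun _ : Fin N => μ)
        {x : Fin N → E | 0 < fillDist M x ∧ t ≤ Φ (fillDist M x / c₁)} = 0 := by
      rw [measure_eq_zero_iff_ae_notMem]
      filter_upwards [hmem] with x hx ⟨hpos, hle⟩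
      have hr : 0 < fillDist M x / c₁ := div_pos hpos hc₁
      obtain ⟨a, ha, har, hat⟩ : ∃ a, 0 < a ∧ a < fillDist M x / c₁ ∧ Φ a < t := by
        have h := (hΦ0.eventually (gt_mem_nhds ht)).and (Ioo_mem_nhdsGT hr)
        obtain ⟨a, h1, h2⟩ := h.exists
        exact ⟨a, h2.1, h2.2, h1⟩
      obtain ⟨s, hs, hst⟩ := intermediate_value_Icc har.le
        (hΦcont.mono fun _ hy => ha.trans_le hy.1) ⟨hat.le, hle⟩
      exact hex ⟨s, ha.trans_le hs.1, hs.2.trans_lt (hlt x hx), hst⟩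
    exact hnull.trans_le zero_le
end

section
/- Let (E, dist) be a metric space, M ⊆ E a nonempty compact subset, and μ a Borel probability measure on E with μ(E ∖ M) = 0. Let q > 0 and suppose there exist constants c > 0 and r₀ > 0 such that μ(B(x, r)) ≥ c·r^q for every x ∈ M and every r ∈ (0, r₀). Let γ > 0 and C₀ ≥ 0, and for each integer N ≥ 2 let e_N : E^N → [0, ∞) be any error functional satisfying the deterministic bound e_N(x₁, …, x_N) ≤ C₀·h_M(x₁, …, x_N)^γ for every tuple (x₁, …, x_N) ∈ E^N. Then there exists a constant C > 0, independent of N and δ, such that for every integer N ≥ 2 and every δ ∈ (0, 1), the product measure μ^{⊗N} of the set of N-tuples (x₁, …, x_N) ∈ E^N with e_N(x₁, …, x_N) ≤ C·(log(N/δ)/N)^{γ/q} is at least 1 − δ. -/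
open MeasureTheory

/-- An `r`-separated finite set of points whose `r / 2`-balls have mass at least `m` has at most
`1 / m` elements. -/
lemma card_mul_le_one_of_separated {E : Type*} [MetricSpace E] [MeasurableSpace E] [BorelSpace E]
    (μ : Measure E) [IsProbabilityMeasure μ] {r m : ℝ} (S : Finset E)
    (hsep : (S : Set E).Pairwise fun x y => r ≤ dist x y)
    (hball : ∀ x ∈ S, ENNReal.ofReal m ≤ μ (Metric.ball x (r / 2))) :
    (S.card : ℝ) * m ≤ 1 := by
  have hdisj : (S : Set E).PairwiseDisjoint fun x => Metric.ball x (r / 2) := by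
    intro x hx y hy hxy
    refine Metric.ball_disjoint_ball ?_
    linarith [hsep hx hy hxy]
  have hsum : (S.card : ENNReal) * ENNReal.ofReal m ≤ 1 := by
    calc (S.card : ENNReal) * ENNReal.ofReal m
        = ∑ _x ∈ S, ENNReal.ofReal m := by simp
      _ ≤ ∑ x ∈ S, μ (Metric.ball x (r / 2)) := Finset.sum_le_sum hball
      _ = μ (⋃ x ∈ S, Metric.ball x (r / 2)) :=
          (measure_biUnion_finset hdisj fun _ _ => measurableSet_ball).symm
      _ ≤ 1 := prob_le_one
  rw [← ENNReal.ofReal_natCast, ← ENNReal.ofReal_mul (Nat.cast_nonneg _),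
    ENNReal.ofReal_le_one] at hsum
  exact hsum

/-- If every `r / 2`-ball centered in `M` has mass at least `m > 0`, then `M` has an `r`-net with
at most `1 / m` elements. -/
lemma exists_net_card_mul_le_one {E : Type*} [MetricSpace E] [MeasurableSpace E] [BorelSpace E]
    (μ : Measure E) [IsProbabilityMeasure μ] (M : Set E) {r m : ℝ} (hm : 0 < m)
    (hball : ∀ x ∈ M, ENNReal.ofReal m ≤ μ (Metric.ball x (r / 2))) :
    ∃ S : Finset E, (S : Set E) ⊆ M ∧ (∀ x ∈ M, x ∉ S → ∃ s ∈ S, dist x s < r) ∧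
      (S.card : ℝ) * m ≤ 1 := by
  classical
  let F : Set (Finset E) :=
    {S | (S : Set E) ⊆ M ∧ (S : Set E).Pairwise fun x y => r ≤ dist x y}
  have hcard : ∀ S ∈ F, (S.card : ℝ) * m ≤ 1 := fun S hS =>
    card_mul_le_one_of_separated μ S hS.2 fun x hx => hball x (hS.1 hx)
  have hfin : (Finset.card '' F).Finite := by
    refine (Set.finite_Iic ⌈1 / m⌉₊).subset ?_
    rintro _ ⟨S, hS, rfl⟩
    have h : (S.card : ℝ) ≤ ⌈1 / m⌉₊ :=
      ((le_div_iff₀ hm).2 (hcard S hS)).trans (Nat.le_ceil _)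
    exact_mod_cast h
  obtain ⟨S, hS, hmax⟩ := Set.Finite.exists_maximalFor' Finset.card F hfin ⟨∅, by simp [F]⟩
  refine ⟨S, hS.1, fun x hx hxS => ?_, hcard S hS⟩
  by_contra! hfar
  have hins : insert x S ∈ F := by
    refine ⟨?_, ?_⟩
    · rw [Finset.coe_insert]
      exact Set.insert_subset hx hS.1
    · rw [Finset.coe_insert]
      refine hS.2.insert fun y hy _ => ⟨hfar y hy, ?_⟩
      rw [dist_comm]
      exact hfar y hy
  have hle := hmax hins (Finset.card_le_card (Finset.subset_insert x S))
  rw [Finset.card_insert_of_notMem hxS] at hle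
  omega

lemma fillDist_nonneg {E : Type*} [MetricSpace E] {N : ℕ} (M : Set E) (x : Fin N → E) :
    0 ≤ fillDist M x :=
  Real.iSup_nonneg fun _ => Real.iInf_nonneg fun _ => dist_nonneg

lemma fillDist_le {E : Type*} [MetricSpace E] {N : ℕ} {M : Set E} (hM : M.Nonempty)
    {x : Fin N → E} {t : ℝ} (h : ∀ y ∈ M, ∃ i, dist y (x i) ≤ t) : fillDist M x ≤ t := by
  have : Nonempty M := hM.to_subtype
  refine ciSup_le fun y => ?_
  obtain ⟨i, hi⟩ := h y y.2
  exact ciInf_le_of_le ⟨0, by rintro _ ⟨j, rfl⟩; exact dist_nonneg⟩ i hi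

/-- The probability that one of the balls centered in a finite set is missed by all of `N`
independent samples. -/
lemma measure_pi_exists_forall_notMem_ball_le {E : Type*} [MetricSpace E] [MeasurableSpace E]
    [BorelSpace E] (μ : Measure E) [IsProbabilityMeasure μ] {r m : ℝ} (S : Finset E)
    (hm : 0 ≤ m) (hball : ∀ x ∈ S, ENNReal.ofReal m ≤ μ (Metric.ball x r)) (N : ℕ) :
    (Measure.pi fun _ : Fin N => μ) {x | ∃ s ∈ S, ∀ i, x i ∉ Metric.ball s r} ≤
      ENNReal.ofReal (S.card * Real.exp (-(N * m))) := by
  have hset : {x : Fin N → E | ∃ s ∈ S, ∀ i, x i ∉ Metric.ball s r} =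
      ⋃ s ∈ S, Set.univ.pi fun _ : Fin N => (Metric.ball s r)ᶜ := by
    ext x
    simp
  rw [hset]
  refine (measure_biUnion_finset_le _ _).trans ?_
  have hone : ∀ s ∈ S, (Measure.pi fun _ : Fin N => μ)
      (Set.univ.pi fun _ : Fin N => (Metric.ball s r)ᶜ) ≤
        ENNReal.ofReal (Real.exp (-(N * m))) := by
    intro s hs
    have hcompl : μ (Metric.ball s r)ᶜ ≤ ENNReal.ofReal (Real.exp (-m)) := by
      rw [prob_compl_eq_one_sub measurableSet_ball]
      calc 1 - μ (Metric.ball s r) ≤ 1 - ENNReal.ofReal m := tsub_le_tsub_left (hball s hs) 1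
        _ = ENNReal.ofReal (1 - m) := by rw [ENNReal.ofReal_sub _ hm, ENNReal.ofReal_one]
        _ ≤ ENNReal.ofReal (Real.exp (-m)) :=
            ENNReal.ofReal_le_ofReal (Real.one_sub_le_exp_neg m)
    rw [Measure.pi_pi]
    calc ∏ _i : Fin N, μ (Metric.ball s r)ᶜ
        = μ (Metric.ball s r)ᶜ ^ N := by simp
      _ ≤ ENNReal.ofReal (Real.exp (-m)) ^ N := by gcongr
      _ = ENNReal.ofReal (Real.exp (-(N * m))) := by
          rw [← ENNReal.ofReal_pow (Real.exp_pos _).le, ← Real.exp_nat_mul, mul_neg]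
  refine (Finset.sum_le_sum hone).trans_eq ?_
  rw [Finset.sum_const, nsmul_eq_mul, ENNReal.ofReal_mul (Nat.cast_nonneg _),
    ENNReal.ofReal_natCast]

/-- Tail bound for the fill distance of `N` independent samples at a fixed scale `r`. -/
lemma le_measure_pi_fillDist_le {E : Type*} [MetricSpace E] [MeasurableSpace E] [BorelSpace E]
    (μ : Measure E) [IsProbabilityMeasure μ] {M : Set E} (hM : M.Nonempty) {r m m' : ℝ}
    (hr : 0 < r) (hm : 0 < m) (hm' : 0 < m')
    (hball : ∀ x ∈ M, ENNReal.ofReal m ≤ μ (Metric.ball x r))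
    (hball' : ∀ x ∈ M, ENNReal.ofReal m' ≤ μ (Metric.ball x (r / 2))) (N : ℕ) :
    ENNReal.ofReal (1 - Real.exp (-(N * m)) / m') ≤
      (Measure.pi fun _ : Fin N => μ) {x | fillDist M x ≤ 2 * r} := by
  obtain ⟨S, hSM, hnet, hcard⟩ := exists_net_card_mul_le_one μ M hm' hball'
  have hbad := measure_pi_exists_forall_notMem_ball_le μ S hm.le
    (fun x hx => hball x (hSM hx)) N
  have hsub : {x : Fin N → E | ∃ s ∈ S, ∀ i, x i ∉ Metric.ball s r}ᶜ ⊆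
      {x | fillDist M x ≤ 2 * r} := by
    intro x hx
    simp only [Set.mem_compl_iff, Set.mem_ofPred_eq, not_exists, not_and, not_forall, not_not,
      Metric.mem_ball] at hx
    refine fillDist_le hM fun y hy => ?_
    obtain ⟨s, hs, hys⟩ : ∃ s ∈ S, dist y s < r := by
      by_cases hyS : y ∈ S
      · exact ⟨y, hyS, by simpa using hr⟩
      · exact hnet y hy hyS
    obtain ⟨i, hi⟩ := hx s hs
    refine ⟨i, ?_⟩
    linarith [dist_triangle_right y (x i) s]
  refine le_trans ?_ (measure_mono hsub)
  have hexp : (S.card : ℝ) * Real.exp (-(N * m)) ≤ Real.exp (-(N * m)) / m' := by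
    rw [le_div_iff₀ hm']
    nlinarith [Real.exp_pos (-(N * m))]
  calc ENNReal.ofReal (1 - Real.exp (-(N * m)) / m')
      ≤ ENNReal.ofReal (1 - S.card * Real.exp (-(N * m))) :=
        ENNReal.ofReal_le_ofReal (by linarith)
    _ = 1 - ENNReal.ofReal (S.card * Real.exp (-(N * m))) := by
        rw [ENNReal.ofReal_sub _ (by positivity), ENNReal.ofReal_one]
    _ ≤ 1 - (Measure.pi fun _ : Fin N => μ)
          {x : Fin N → E | ∃ s ∈ S, ∀ i, x i ∉ Metric.ball s r} := tsub_le_tsub_left hbad 1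
    _ ≤ _ := by
        rw [tsub_le_iff_left, ← measure_univ (μ := Measure.pi fun _ : Fin N => μ)]
        exact (measure_mono (Set.union_compl_self _).ge).trans (measure_union_le _ _)

/-- Samples from a probability measure concentrated on a bounded set `M` have fill distance at
most the diameter of `M`. -/
lemma measure_pi_fillDist_le_diam {E : Type*} [MetricSpace E] [MeasurableSpace E] [BorelSpace E]
    (μ : Measure E) [IsProbabilityMeasure μ] {M : Set E} (hM : M.Nonempty)
    (hMb : Bornology.IsBounded M) (hsupp : μ Mᶜ = 0) {N : ℕ} (hN : 0 < N) :
    (Measure.pi fun _ : Fin N => μ) {x | fillDist M x ≤ Metric.diam M} = 1 := by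
  refine le_antisymm prob_le_one ?_
  have hμM : μ M = 1 := by rw [measure_of_measure_compl_eq_zero hsupp, measure_univ]
  have hpi : (Measure.pi fun _ : Fin N => μ) (Set.univ.pi fun _ : Fin N => M) = 1 := by
    rw [Measure.pi_pi]
    simp [hμM]
  rw [← hpi]
  refine measure_mono fun x hx => fillDist_le hM fun y hy => ⟨⟨0, hN⟩, ?_⟩
  exact Metric.dist_le_diam_of_mem hMb hy (hx _ (Set.mem_univ _))

/-- The scale at which the tail bound reaches the confidence level `δ`: if
`p = 1 + 2 ^ q / log 2` and `c * r ^ q = p * log (N / δ) / N`, then the failure probability is at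
most `δ`. -/
lemma exp_neg_div_le_of_scale {q c r p δ : ℝ} {N : ℕ} (hp : p = 1 + 2 ^ q / Real.log 2)
    (hr : 0 < r) (hN : 2 ≤ N) (hδ : 0 < δ) (hδ1 : δ < 1)
    (hscale : c * r ^ q = p * (Real.log (N / δ) / N)) :
    Real.exp (-(N * (c * r ^ q))) / (c * (r / 2) ^ q) ≤ δ := by
  have hN2 : (2 : ℝ) ≤ N := by exact_mod_cast hN
  have hN0 : (0 : ℝ) < N := by linarith
  have hlog2 : 0 < Real.log 2 := Real.log_pos (by norm_num)
  have h2q : (0 : ℝ) < 2 ^ q := by positivity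
  have hNδ : (2 : ℝ) ≤ N / δ := by
    rw [le_div_iff₀ hδ]
    nlinarith
  have hlog : Real.log 2 ≤ Real.log (N / δ) := Real.log_le_log (by norm_num) hNδ
  have hp1 : 1 ≤ p := by
    rw [hp]
    linarith [div_pos h2q hlog2]
  have hplog : 2 ^ q ≤ p * Real.log 2 := by
    rw [hp, add_mul, div_mul_cancel₀ _ hlog2.ne']
    linarith
  have hexp : Real.exp (-(N * (c * r ^ q))) ≤ δ / N := by
    have h1 : (N : ℝ) * (c * r ^ q) = p * Real.log (N / δ) := by
      rw [hscale]
      field_simp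
    rw [h1]
    calc Real.exp (-(p * Real.log (N / δ))) ≤ Real.exp (-Real.log (N / δ)) := by
          refine Real.exp_le_exp.2 (neg_le_neg ?_)
          nlinarith
      _ = δ / N := by rw [Real.exp_neg, Real.exp_log (by linarith), inv_div]
  have hden : 1 / (N : ℝ) ≤ c * (r / 2) ^ q := by
    rw [Real.div_rpow hr.le (by norm_num), ← mul_div_assoc, hscale, div_le_div_iff₀ hN0 h2q]
    have h1 : p * (Real.log (N / δ) / N) * N = p * Real.log (N / δ) := by field_simp
    rw [h1]
    nlinarith
  rw [div_le_iff₀ (lt_of_lt_of_le (by positivity) hden)]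
  calc Real.exp (-(N * (c * r ^ q))) ≤ δ * (1 / N) := by rw [mul_one_div]; exact hexp
    _ ≤ δ * (c * (r / 2) ^ q) := by gcongr

/-- High-probability rate for the fill distance of independent samples. -/
lemma exists_le_measure_pi_fillDist_le {E : Type*} [MetricSpace E] [MeasurableSpace E]
    [BorelSpace E] {M : Set E} (hMb : Bornology.IsBounded M) (hM : M.Nonempty)
    (μ : Measure E) [IsProbabilityMeasure μ] (hsupp : μ Mᶜ = 0)
    {q c r₀ : ℝ} (hq : 0 < q) (hc : 0 < c) (hr₀ : 0 < r₀)
    (hball : ∀ x ∈ M, ∀ r : ℝ, 0 < r → r < r₀ →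
      ENNReal.ofReal (c * r ^ q) ≤ μ (Metric.ball x r)) :
    ∃ B : ℝ, 0 < B ∧ ∀ N : ℕ, 2 ≤ N → ∀ δ : ℝ, 0 < δ → δ < 1 →
      ENNReal.ofReal (1 - δ) ≤ (Measure.pi fun _ : Fin N => μ)
        {x | fillDist M x ≤ B * (Real.log (N / δ) / N) ^ (1 / q)} := by
  obtain ⟨p, hp⟩ : ∃ p : ℝ, p = 1 + 2 ^ q / Real.log 2 := ⟨_, rfl⟩
  have hp0 : 0 < p := by
    rw [hp]
    have := Real.log_pos (show (1 : ℝ) < 2 by norm_num)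
    positivity
  refine ⟨max 2 (Metric.diam M / r₀) * (p / c) ^ (1 / q), by positivity, ?_⟩
  intro N hN δ hδ hδ1
  have hN2 : (2 : ℝ) ≤ N := by exact_mod_cast hN
  have hlog : 0 < Real.log (N / δ) := by
    refine Real.log_pos ((one_lt_div hδ).2 (by linarith))
  have hL : 0 < Real.log (N / δ) / N := by positivity
  set r : ℝ := (p / c) ^ (1 / q) * (Real.log (N / δ) / N) ^ (1 / q) with hr_def
  have hr : 0 < r := by positivity
  have hscale : c * r ^ q = p * (Real.log (N / δ) / N) := by
    rw [hr_def, ← Real.mul_rpow (by positivity) hL.le, ← Real.rpow_mul (by positivity),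
      one_div_mul_cancel hq.ne', Real.rpow_one]
    field_simp
  rw [mul_assoc, ← hr_def]
  rcases lt_or_ge r r₀ with hlt | hge
  · calc ENNReal.ofReal (1 - δ)
        ≤ ENNReal.ofReal (1 - Real.exp (-(N * (c * r ^ q))) / (c * (r / 2) ^ q)) :=
          ENNReal.ofReal_le_ofReal
            (by linarith [exp_neg_div_le_of_scale hp hr hN hδ hδ1 hscale])
      _ ≤ (Measure.pi fun _ : Fin N => μ) {x | fillDist M x ≤ 2 * r} :=
          le_measure_pi_fillDist_le μ hM hr (by positivity) (by positivity)
            (fun x hx => hball x hx r hr hlt)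
            (fun x hx => hball x hx (r / 2) (by linarith) (by linarith)) N
      _ ≤ _ := measure_mono fun x (hx : fillDist M x ≤ 2 * r) =>
          hx.trans (mul_le_mul_of_nonneg_right (le_max_left _ _) hr.le)
  · have hdiam : Metric.diam M ≤ max 2 (Metric.diam M / r₀) * r :=
      calc Metric.diam M = Metric.diam M / r₀ * r₀ := by field_simp
        _ ≤ max 2 (Metric.diam M / r₀) * r := by
          gcongr
          exact le_max_right _ _
    calc ENNReal.ofReal (1 - δ) ≤ 1 := ENNReal.ofReal_le_one.2 (by linarith)
      _ = (Measure.pi fun _ : Fin N => μ) {x | fillDist M x ≤ Metric.diam M} :=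
          (measure_pi_fillDist_le_diam μ hM hMb hsupp (by omega)).symm
      _ ≤ _ := measure_mono fun x (hx : fillDist M x ≤ Metric.diam M) => hx.trans hdiam

/-- Probabilistic convergence rate for any error functional controlled by a
power of the fill distance of i.i.d. collocation points. -/
theorem error_bound_random_collocation
    {E : Type*} [MetricSpace E] [MeasurableSpace E] [BorelSpace E]
    (M : Set E) (hMc : IsCompact M) (hMne : M.Nonempty)
    (μ : Measure E) [IsProbabilityMeasure μ] (hsupp : μ Mᶜ = 0)
    (q : ℝ) (hq : 0 < q)
    (c r₀ : ℝ) (hc : 0 < c) (hr₀ : 0 < r₀)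
    (hball : ∀ x ∈ M, ∀ r : ℝ, 0 < r → r < r₀ →
      ENNReal.ofReal (c * r ^ q) ≤ μ (Metric.ball x r))
    (γ C₀ : ℝ) (hγ : 0 < γ) (hC₀ : 0 ≤ C₀)
    (e : (N : ℕ) → (Fin N → E) → ℝ)
    (he_nonneg : ∀ (N : ℕ) (x : Fin N → E), 0 ≤ e N x)
    (he_bound : ∀ N : ℕ, 2 ≤ N → ∀ x : Fin N → E,
      e N x ≤ C₀ * fillDist M x ^ γ) :
    ∃ C : ℝ, 0 < C ∧ ∀ N : ℕ, 2 ≤ N → ∀ δ : ℝ, 0 < δ → δ < 1 →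
      ENNReal.ofReal (1 - δ) ≤
        (Measure.pi fun _ : Fin N => μ)
          {x : Fin N → E |
            e N x ≤ C * (Real.log ((N : ℝ) / δ) / (N : ℝ)) ^ (γ / q)} := by
  obtain ⟨B, hB, hfill⟩ :=
    exists_le_measure_pi_fillDist_le hMc.isBounded hMne μ hsupp hq hc hr₀ hball
  refine ⟨C₀ * B ^ γ + 1, by positivity, fun N hN δ hδ hδ1 => ?_⟩
  refine (hfill N hN δ hδ hδ1).trans (measure_mono fun x hx => ?_)
  have hL : 0 ≤ Real.log ((N : ℝ) / δ) / (N : ℝ) := by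
    have hN1 : (1 : ℝ) ≤ N := by exact_mod_cast (by omega : 1 ≤ N)
    have := Real.log_nonneg ((one_le_div hδ).2 (hδ1.le.trans hN1))
    positivity
  calc e N x ≤ C₀ * fillDist M x ^ γ := he_bound N hN x
    _ ≤ C₀ * (B * (Real.log ((N : ℝ) / δ) / (N : ℝ)) ^ (1 / q)) ^ γ := by
        gcongr
        · exact fillDist_nonneg M x
        · exact hx
    _ = C₀ * B ^ γ * (Real.log ((N : ℝ) / δ) / (N : ℝ)) ^ (γ / q) := by
        rw [Real.mul_rpow hB.le (by positivity), ← Real.rpow_mul hL, one_div_mul_eq_div,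
          mul_assoc]
    _ ≤ (C₀ * B ^ γ + 1) * (Real.log ((N : ℝ) / δ) / (N : ℝ)) ^ (γ / q) := by
        gcongr
        linarith
end
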